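/- Block transposition lemma: Let α be a path in the race-detecting state graph with blocks B_1,…,B_N and block-event string b_1⋯b_N. Suppose 1 ≤ i < N, B_i is not initial, B_{i+1} is complete, the first statement of B_i does not happen before the first statement of B_{i+1}, and no statement of B_i conflicts with a statement of B_{i+1}. Then b_1⋯b_{i−1} b_{i+1} b_i b_{i+2}⋯b_N is the block-event string of a path α' from the same initial node in G, with DR of the execution of α' equal to DR of the execution of α. -/

import Mathlib

namespace MC

/-- Statements of a thread: acquire/release a lock, barrier exit, or an nsync statement. -/
inductive Stmt (Lock NStmt : Type) where
  | acquire : Lock → Stmt Lock NStmt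
  | release : Lock → Stmt Lock NStmt
  | exit : Stmt Lock NStmt
  | nsync : NStmt → Stmt Lock NStmt

/-- The kind of a local state: acquire state (with its lock), release state,
barrier state, nsync state, or terminal state. -/
inductive LKind (Lock : Type) where
  | acquire : Lock → LKind Lock
  | release : Lock → LKind Lock
  | barrier : LKind Lock
  | nsync : LKind Lock
  | term : LKind Lock

def LKind.isBarrier {L : Type} : LKind L → Bool
  | .barrier => true
  | _ => false

def LKind.isTerm {L : Type} : LKind L → Bool
  | .term => true
  | _ => false

/-- A multithreaded program with thread ID set `Fin n`. -/
structure Program where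
  n : ℕ
  npos : 0 < n
  Lock : Type
  Shared : Type
  Local : Fin n → Type
  NStmt : Fin n → Type
  kind : ∀ i, Local i → LKind Lock
  next : ∀ i, Local i → Local i
  stmts : ∀ i, Local i → Set (NStmt i)
  stmtsNonempty : ∀ i σ, kind i σ = .nsync → (stmts i σ).Nonempty
  update : ∀ i, Local i → NStmt i → Shared → Local i × Shared

variable {P : Program}

/-- Global statements: a thread ID together with one of its statements. -/
abbrev GStmt (P : Program) := Σ i : Fin P.n, Stmt P.Lock (P.NStmt i)

def GStmt.isNsync (t : GStmt P) : Prop := ∃ m, t.2 = Stmt.nsync m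
def GStmt.isExit (t : GStmt P) : Prop := t.2 = Stmt.exit
def GStmt.isExitZero (t : GStmt P) : Prop := t.2 = Stmt.exit ∧ (t.1 : ℕ) = 0
def GStmt.isReleaseOn (t : GStmt P) (l : P.Lock) : Prop := t.2 = Stmt.release l
def GStmt.isAcquireOn (t : GStmt P) (l : P.Lock) : Prop := t.2 = Stmt.acquire l

/-- A global state: local state of each thread, shared state, lock state
(`none` = free), and barrier wait set. -/
structure GState (P : Program) where
  loc : ∀ i, P.Local i
  sh : P.Shared
  lk : P.Lock → Option (Fin P.n)
  wait : Set (Fin P.n)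

/-- Enabledness of a statement at a global state. -/
def Enabled (s : GState P) : GStmt P → Prop
  | ⟨i, st⟩ =>
    match P.kind i (s.loc i), st with
    | .acquire l, .acquire l' => l = l' ∧ s.lk l = none
    | .release l, .release l' => l = l' ∧ s.lk l = some i
    | .barrier, .exit => i ∉ s.wait
    | .nsync, .nsync m => m ∈ P.stmts i (s.loc i)
    | _, _ => False

open Classical in
/-- Execution of a statement at a global state. -/
noncomputable def execute (s : GState P) : GStmt P → GState P
  | ⟨i, st⟩ =>
    let r : P.Local i × P.Shared × (P.Lock → Option (Fin P.n)) :=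
      match st with
      | .acquire l => (P.next i (s.loc i), s.sh, fun l' => if l' = l then some i else s.lk l')
      | .release l => (P.next i (s.loc i), s.sh, fun l' => if l' = l then none else s.lk l')
      | .exit => (P.next i (s.loc i), s.sh, s.lk)
      | .nsync m => ((P.update i (s.loc i) m s.sh).1, (P.update i (s.loc i) m s.sh).2, s.lk)
    { loc := Function.update s.loc i r.1
      sh := r.2.1
      lk := r.2.2
      wait :=
        if (P.kind i r.1).isBarrier then
          (if s.wait ∪ {i} = Set.univ then (∅ : Set (Fin P.n)) else s.wait ∪ {i})
        else s.wait }

/-- Finite executions: `Exec s ts sf` means the statement sequence `ts` is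
step-by-step enabled starting from `s` and leads to `sf`. -/
inductive Exec : GState P → List (GStmt P) → GState P → Prop
  | nil (s : GState P) : Exec s [] s
  | cons {s s' sf : GState P} {t : GStmt P} {l : List (GStmt P)} :
      Enabled s t → execute s t = s' → Exec s' l sf → Exec s (t :: l) sf

/-- The program has no barrier local states. -/
def NoBarriers (P : Program) : Prop := ∀ i σ, P.kind i σ ≠ LKind.barrier

/-! ### Traces, events, happens-before, data races -/

/-- The thread ID of the event at position `k` of a trace (if any). -/
def tidAt (ts : List (GStmt P)) (k : ℕ) : Option (Fin P.n) := (ts[k]?).map (·.1)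

/-- The statement at position `k` satisfies `p`. -/
def stmtIs (ts : List (GStmt P)) (k : ℕ) (p : GStmt P → Prop) : Prop :=
  ∃ t, ts[k]? = some t ∧ p t

/-- Intra-thread order on trace positions. -/
def IntraThread (ts : List (GStmt P)) (j k : ℕ) : Prop :=
  j < k ∧ k < ts.length ∧ tidAt ts j = tidAt ts k

/-- Release-acquire relation on trace positions: a release of `l` is related to
the next subsequent acquire of `l`. -/
def RelAcq (ts : List (GStmt P)) (j k : ℕ) : Prop :=
  ∃ l : P.Lock, j < k ∧ stmtIs ts j (·.isReleaseOn l) ∧ stmtIs ts k (·.isAcquireOn l) ∧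
    ∀ m, j < m → m < k → ¬ stmtIs ts m (·.isAcquireOn l)

/-- The barrier epoch of the event at position `k`: the number of barrier-exit
events of the same thread at positions `≤ k`. -/
noncomputable def epoch (ts : List (GStmt P)) (k : ℕ) : ℕ :=
  Set.ncard {m : ℕ | m ≤ k ∧ tidAt ts m = tidAt ts k ∧ stmtIs ts m (·.isExit)}

/-- Barrier relation on trace positions: earlier epochs happen before later ones. -/
def BarrierRel (ts : List (GStmt P)) (j k : ℕ) : Prop :=
  j < ts.length ∧ k < ts.length ∧ epoch ts j < epoch ts k

/-- The happens-before relation on trace positions. -/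
def HB (ts : List (GStmt P)) : ℕ → ℕ → Prop :=
  Relation.TransGen (fun j k => IntraThread ts j k ∨ RelAcq ts j k ∨ BarrierRel ts j k)

/-- `C` is a conflict relation for `P`: symmetric, relating only nsync statements
from different threads, and non-conflicting nsync statements from different
threads commute whenever both are enabled. -/
structure IsConflictRel (P : Program) (C : GStmt P → GStmt P → Prop) : Prop where
  symm : ∀ t1 t2, C t1 t2 → C t2 t1
  nsync_left : ∀ t1 t2, C t1 t2 → t1.isNsync
  nsync_right : ∀ t1 t2, C t1 t2 → t2.isNsync
  diff : ∀ t1 t2, C t1 t2 → t1.1 ≠ t2.1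
  commute : ∀ t1 t2, t1.isNsync → t2.isNsync → t1.1 ≠ t2.1 → ¬ C t1 t2 →
    ∀ s : GState P, Enabled s t1 → Enabled s t2 →
      execute (execute s t1) t2 = execute (execute s t2) t1

/-- The events at positions `j` and `k` race: their statements conflict and the
positions are unordered by happens-before. -/
def Races (C : GStmt P → GStmt P → Prop) (ts : List (GStmt P)) (j k : ℕ) : Prop :=
  (∃ t1 t2, ts[j]? = some t1 ∧ ts[k]? = some t2 ∧ C t1 t2) ∧ ¬ HB ts j k ∧ ¬ HB ts k j

/-- The trace contains a data race. -/
def HasRace (C : GStmt P → GStmt P → Prop) (ts : List (GStmt P)) : Prop :=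
  ∃ j k, Races C ts j k

/-- The event (statement with per-thread occurrence number) at position `k`. -/
def eventAt (ts : List (GStmt P)) (k : ℕ) : Option (GStmt P × ℕ) :=
  (ts[k]?).map (fun t => (t, (ts.take (k+1)).countP (fun t' => decide (t'.1 = t.1))))

/-- The set of events of a trace. -/
def events (ts : List (GStmt P)) : Set (GStmt P × ℕ) :=
  {e | ∃ k, eventAt ts k = some e}

/-! ### The race-detecting state graph -/

/-- The edge relation of the local graph of thread `i`. -/
def isLocalStep (i : Fin P.n) (σ σ' : P.Local i) : Prop :=
  match P.kind i σ with
  | .nsync => ∃ m ζ, m ∈ P.stmts i σ ∧ (P.update i σ m ζ).1 = σ'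
  | .term => False
  | _ => σ' = P.next i σ

/-- Choice of sets `R i` containing all acquire and release local states and
meeting every cycle of the local graph of thread `i`. -/
structure RSets (P : Program) where
  R : ∀ i, Set (P.Local i)
  acq_mem : ∀ i σ l, P.kind i σ = LKind.acquire l → σ ∈ R i
  rel_mem : ∀ i σ l, P.kind i σ = LKind.release l → σ ∈ R i
  acyclic : ∀ i σ, σ ∉ R i →
    ¬ Relation.TransGen (fun a b => a ∉ R i ∧ b ∉ R i ∧ isLocalStep i a b) σ σ

/-- Thread `i` is normal at state `s`: its local state is not in `R i` and it
has an enabled statement. -/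
def Normal (RS : RSets P) (s : GState P) (i : Fin P.n) : Prop :=
  s.loc i ∉ RS.R i ∧ ∃ st : Stmt P.Lock (P.NStmt i), Enabled s ⟨i, st⟩

/-- A node of the race-detecting state graph: a state together with, for each
thread, the set of nsync statements recorded since its last synchronization. -/
structure RNode (P : Program) where
  st : GState P
  hist : ∀ i, Set (P.NStmt i)

/-- Edge relation of the race-detecting state graph. -/
def REdge (RS : RSets P) (u : RNode P) (t : GStmt P) (v : RNode P) : Prop :=
  Enabled u.st t ∧ v.st = execute u.st t ∧
  (∀ m, t.2 = Stmt.nsync m → v.hist t.1 = insert m (u.hist t.1)) ∧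
  (¬ t.isNsync →
    ((t.isExitZero ∨ u.st.loc t.1 ∈ RS.R t.1) → v.hist t.1 = ∅) ∧
    (¬ (t.isExitZero ∨ u.st.loc t.1 ∈ RS.R t.1) → v.hist t.1 = u.hist t.1)) ∧
  (∀ i, i ≠ t.1 →
    (t.isExitZero → v.hist i = ∅) ∧ (¬ t.isExitZero → v.hist i = u.hist i)) ∧
  ((∃ i, Normal RS u.st i) → Normal RS u.st t.1 ∧ ∀ j, Normal RS u.st j → t.1 ≤ j)

/-- Paths in the race-detecting state graph. -/
inductive RPath (RS : RSets P) : RNode P → List (GStmt P) → RNode P → Prop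
  | nil (u : RNode P) : RPath RS u [] u
  | cons {u v w : RNode P} {t : GStmt P} {l : List (GStmt P)} :
      REdge RS u t v → RPath RS v l w → RPath RS u (t :: l) w

/-- Reachability in the race-detecting state graph. -/
def RReach (RS : RSets P) (u v : RNode P) : Prop := ∃ l, RPath RS u l v

/-- Thread `i` detects a race at node `u`. -/
def ThreadDetects (C : GStmt P → GStmt P → Prop) (u : RNode P) (i : Fin P.n) : Prop :=
  ∃ j, j ≠ i ∧ ∃ m1 ∈ u.hist i, ∃ m2 ∈ u.hist j,
    C ⟨i, Stmt.nsync m1⟩ ⟨j, Stmt.nsync m2⟩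

/-- The edge `(u,t,v)` detects a race: the moving thread arrives at an `R i`,
barrier, or terminal local state and detects a race at the target node. -/
def EdgeDetects (RS : RSets P) (C : GStmt P → GStmt P → Prop)
    (u : RNode P) (t : GStmt P) (v : RNode P) : Prop :=
  REdge RS u t v ∧
  (v.st.loc t.1 ∈ RS.R t.1 ∨ (P.kind t.1 (v.st.loc t.1)).isBarrier = true ∨
    (P.kind t.1 (v.st.loc t.1)).isTerm = true) ∧
  ThreadDetects C v t.1

/-- The race-detecting state graph detects a race from `u0`. -/
def DetectsFrom (RS : RSets P) (C : GStmt P → GStmt P → Prop) (u0 : RNode P) : Prop :=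
  ∃ u t v, RReach RS u0 u ∧ EdgeDetects RS C u t v

/-- The initial node for state `s0`: all recorded sets empty. -/
def initNode (s0 : GState P) : RNode P := ⟨s0, fun _ => ∅⟩

/-! ### Abstract state graphs and density -/

/-- A state graph of `P`. -/
structure StateGraph (P : Program) where
  V : Type
  edge : V → GStmt P → V → Prop
  stateOf : V → GState P
  edge_enabled : ∀ {u t v}, edge u t v → Enabled (stateOf u) t
  edge_exec : ∀ {u t v}, edge u t v → stateOf v = execute (stateOf u) t
  edge_det : ∀ {u t v v'}, edge u t v → edge u t v' → v = v'

/-- The ample set of a node: the labels of its outgoing edges. -/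
def StateGraph.ample (G : StateGraph P) (u : G.V) : Set (GStmt P) :=
  {t | ∃ v, G.edge u t v}

/-- Paths in a state graph. -/
inductive GPath (G : StateGraph P) : G.V → List (GStmt P) → G.V → Prop
  | nil (u : G.V) : GPath G u [] u
  | cons {u v w : G.V} {t : GStmt P} {l : List (GStmt P)} :
      G.edge u t v → GPath G v l w → GPath G u (t :: l) w

/-- Density of a state graph (the four ample-set conditions). -/
def StateGraph.IsDense (G : StateGraph P) : Prop :=
  (∀ u, (∃ t, Enabled (G.stateOf u) t) → (G.ample u).Nonempty) ∧
  (∀ u t t', t ∈ G.ample u → Enabled (G.stateOf u) t' → t'.1 = t.1 → t' ∈ G.ample u) ∧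
  (∀ u, G.ample u ≠ {t | Enabled (G.stateOf u) t} → ∀ t ∈ G.ample u, t.isNsync) ∧
  (∀ u l, l ≠ [] → GPath G u l u →
    ∃ v l1 l2, l = l1 ++ l2 ∧ GPath G u l1 v ∧
      G.ample v = {t | Enabled (G.stateOf v) t})

/-! ### Paths as functions and block decompositions -/

/-- A path in the race-detecting state graph presented as a node function `f`
along a statement list `ts`. -/
def IsPathFn (RS : RSets P) (f : ℕ → RNode P) (ts : List (GStmt P)) : Prop :=
  ∀ k (h : k < ts.length), REdge RS (f k) (ts.get ⟨k, h⟩) (f (k+1))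

/-- The statement at position `m` continues the block started at position `b`:
it is from the same thread and that thread is normal at the node it executes from. -/
def SameBlockStep (RS : RSets P) (f : ℕ → RNode P) (ts : List (GStmt P)) (b m : ℕ) : Prop :=
  tidAt ts m = tidAt ts b ∧ ∃ t, ts[m]? = some t ∧ Normal RS (f m).st t.1

/-- `c 0 = 0 < c 1 < ⋯ < c N = |ts|` is the block decomposition of the path
`(f, ts)`: block `j` covers positions `[c j, c (j+1))`. -/
structure IsBlockDecomp (RS : RSets P) (f : ℕ → RNode P) (ts : List (GStmt P))
    (N : ℕ) (c : ℕ → ℕ) : Prop where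
  zero : c 0 = 0
  last : c N = ts.length
  mono : ∀ j, j < N → c j < c (j+1)
  inside : ∀ j, j < N → ∀ m, c j < m → m < c (j+1) → SameBlockStep RS f ts (c j) m
  boundary : ∀ j, j < N → c (j+1) < ts.length → ¬ SameBlockStep RS f ts (c j) (c (j+1))

/-- Block `j` is initial: its thread is normal at its starting node. -/
def BlockInitial (RS : RSets P) (f : ℕ → RNode P) (ts : List (GStmt P))
    (c : ℕ → ℕ) (j : ℕ) : Prop :=
  ∃ t, ts[c j]? = some t ∧ Normal RS (f (c j)).st t.1

/-- Block `j` is complete: its thread is not normal at its final node. -/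
def BlockComplete (RS : RSets P) (f : ℕ → RNode P) (ts : List (GStmt P))
    (c : ℕ → ℕ) (j : ℕ) : Prop :=
  ∀ t, ts[c j]? = some t → ¬ Normal RS (f (c (j+1))).st t.1

/-- The position permutation induced by transposing the adjacent segments
`[a,b)` and `[b,d)`. -/
def segSwap (a b d m : ℕ) : ℕ :=
  if m < a then m else if m < b then m + (d - b) else if m < d then m - (b - a) else m

/-- The position permutation induced by transposing positions `p` and `p+1`. -/
def posSwap (p m : ℕ) : ℕ :=
  if m = p then p + 1 else if m = p + 1 then p else m


/-! ### Helper lemmas -/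

def Touches (t : GStmt P) (l : P.Lock) : Prop := t.2 = Stmt.acquire l ∨ t.2 = Stmt.release l

theorem GState.ext' {s s' : GState P} (h1 : s.loc = s'.loc) (h2 : s.sh = s'.sh)
    (h3 : s.lk = s'.lk) (h4 : s.wait = s'.wait) : s = s' := by
  cases s; cases s'; simp_all

theorem enabled_acquire (s : GState P) (i : Fin P.n) (l : P.Lock) :
    Enabled s ⟨i, .acquire l⟩ ↔ P.kind i (s.loc i) = .acquire l ∧ s.lk l = none := by
  unfold Enabled
  cases h : P.kind i (s.loc i) <;> simp [h]
  rintro rfl; rfl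

theorem enabled_release (s : GState P) (i : Fin P.n) (l : P.Lock) :
    Enabled s ⟨i, .release l⟩ ↔ P.kind i (s.loc i) = .release l ∧ s.lk l = some i := by
  unfold Enabled
  cases h : P.kind i (s.loc i) <;> simp [h]
  rintro rfl; rfl

theorem enabled_nsync (s : GState P) (i : Fin P.n) (m : P.NStmt i) :
    Enabled s ⟨i, .nsync m⟩ ↔ P.kind i (s.loc i) = .nsync ∧ m ∈ P.stmts i (s.loc i) := by
  unfold Enabled
  cases h : P.kind i (s.loc i) <;> simp [h]

theorem enabled_exit (hnb : NoBarriers P) (s : GState P) (i : Fin P.n) :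
    ¬ Enabled s ⟨i, .exit⟩ := by
  unfold Enabled
  have := hnb i (s.loc i)
  cases h : P.kind i (s.loc i) <;> simp_all

theorem exec_loc_ne (s : GState P) (t : GStmt P) {i : Fin P.n} (h : i ≠ t.1) :
    (execute s t).loc i = s.loc i := by
  obtain ⟨k, st⟩ := t
  simp only [execute]
  exact Function.update_of_ne h _ _

theorem exec_wait (hnb : NoBarriers P) (s : GState P) (t : GStmt P) :
    (execute s t).wait = s.wait := by
  obtain ⟨k, st⟩ := t
  have h : ∀ σ, (P.kind k σ).isBarrier = false := by
    intro σ
    have := hnb k σ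
    cases h : P.kind k σ <;> simp_all [LKind.isBarrier]
  simp only [execute, h]
  simp

theorem exec_lk (s : GState P) (t : GStmt P) {l : P.Lock} (h : ¬ Touches t l) :
    (execute s t).lk l = s.lk l := by
  obtain ⟨k, st⟩ := t
  unfold Touches at h
  cases st <;> simp [execute] at h ⊢ <;> intro hh <;> exact absurd hh.symm h

theorem exec_sh (s : GState P) (t : GStmt P) (h : ¬ t.isNsync) :
    (execute s t).sh = s.sh := by
  obtain ⟨k, st⟩ := t
  cases st <;> simp [execute, GStmt.isNsync] at h ⊢

theorem enabled_congr {s s' : GState P} (t : GStmt P) (h1 : s'.loc t.1 = s.loc t.1)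
    (h2 : ∀ l, Touches t l → s'.lk l = s.lk l) (hw : s'.wait = s.wait) :
    Enabled s t → Enabled s' t := by
  obtain ⟨k, st⟩ := t
  simp only at h1
  cases st with
  | acquire l =>
    rw [enabled_acquire, enabled_acquire, h1, h2 l (Or.inl rfl)]; exact id
  | release l =>
    rw [enabled_release, enabled_release, h1, h2 l (Or.inr rfl)]; exact id
  | nsync m => rw [enabled_nsync, enabled_nsync, h1]; exact id
  | exit => unfold Enabled; cases h : P.kind k (s.loc k) <;> simp [h, h1, hw]

structure Indep (C : GStmt P → GStmt P → Prop) (t1 t2 : GStmt P) : Prop where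
  ne : t1.1 ≠ t2.1
  nc : ¬ C t1 t2
  lock : ∀ l, Touches t1 l → ¬ Touches t2 l

theorem exec_loc_self (s s' : GState P) (t : GStmt P) (h : s'.loc t.1 = s.loc t.1)
    (hs : t.isNsync → s'.sh = s.sh) : (execute s' t).loc t.1 = (execute s t).loc t.1 := by
  obtain ⟨k, st⟩ := t
  simp only at h
  cases st <;> simp [execute, h]
  rw [hs ⟨_, rfl⟩]

theorem exec_sh_self (s s' : GState P) (t : GStmt P) (h : s'.loc t.1 = s.loc t.1)
    (hs : s'.sh = s.sh) : (execute s' t).sh = (execute s t).sh := by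
  obtain ⟨k, st⟩ := t
  simp only at h
  cases st <;> simp [execute, h, hs]

theorem exec_lk_touch (s s' : GState P) (t : GStmt P) {l : P.Lock} (h : Touches t l) :
    (execute s' t).lk l = (execute s t).lk l := by
  obtain ⟨k, st⟩ := t
  unfold Touches at h
  cases st <;> simp [execute] at h ⊢ <;> simp [h]

theorem exec_comm (hnb : NoBarriers P) {C : GStmt P → GStmt P → Prop} (hC : IsConflictRel P C)
    {t1 t2 : GStmt P} (hI : Indep C t1 t2) {s : GState P} (h1 : Enabled s t1)
    (h2 : Enabled (execute s t1) t2) :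
    Enabled s t2 ∧ Enabled (execute s t2) t1 ∧
      execute (execute s t1) t2 = execute (execute s t2) t1 := by
  have e2 : Enabled s t2 :=
    enabled_congr t2 (exec_loc_ne s t1 hI.ne.symm).symm
      (fun l hl => (exec_lk s t1 (fun h => hI.lock l h hl)).symm) (exec_wait hnb s t1).symm h2
  refine ⟨e2, enabled_congr t1 (exec_loc_ne s t2 hI.ne)
      (fun l hl => exec_lk s t2 (hI.lock l hl)) (exec_wait hnb s t2) h1, ?_⟩
  by_cases hn : t1.isNsync ∧ t2.isNsync
  · exact hC.commute t1 t2 hn.1 hn.2 hI.ne hI.nc s h1 e2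
  have l1 := exec_loc_ne s t2 hI.ne
  have l2 := exec_loc_ne s t1 hI.ne.symm
  apply GState.ext'
  · funext i
    by_cases hi1 : i = t1.1
    · subst hi1
      rw [exec_loc_ne _ t2 hI.ne]
      exact (exec_loc_self s _ t1 l1 (fun h => exec_sh s t2 (fun h' => hn ⟨h, h'⟩))).symm
    by_cases hi2 : i = t2.1
    · subst hi2
      rw [exec_loc_ne _ t1 hi1]
      exact (exec_loc_self s _ t2 l2 (fun h => exec_sh s t1 (fun h' => hn ⟨h', h⟩)))
    · rw [exec_loc_ne _ _ hi1, exec_loc_ne _ _ hi2, exec_loc_ne _ _ hi1, exec_loc_ne _ _ hi2]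
  · by_cases hn1 : t1.isNsync
    · have hn2 : ¬ t2.isNsync := fun h => hn ⟨hn1, h⟩
      rw [exec_sh _ t2 hn2]
      exact (exec_sh_self s _ t1 l1 (exec_sh s t2 hn2)).symm
    · rw [exec_sh _ t1 hn1]
      exact (exec_sh_self s _ t2 l2 (exec_sh s t1 hn1))
  · funext l
    by_cases ht1 : Touches t1 l
    · rw [exec_lk _ t2 (hI.lock l ht1)]
      exact exec_lk_touch _ _ _ ht1
    · rw [exec_lk _ t1 ht1]
      by_cases ht2 : Touches t2 l
      · exact exec_lk_touch _ _ _ ht2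
      · rw [exec_lk _ t2 ht2, exec_lk _ t2 ht2, exec_lk _ t1 ht1]
  · simp only [exec_wait hnb]

open Classical in
noncomputable def nxHist (RS : RSets P) (σ : ∀ i, P.Local i) (h : ∀ i, Set (P.NStmt i))
    (t : GStmt P) : Set (P.NStmt t.1) :=
  match t.2 with
  | .nsync m => insert m (h t.1)
  | _ => if σ t.1 ∈ RS.R t.1 then ∅ else h t.1

noncomputable def nx (RS : RSets P) (u : RNode P) (t : GStmt P) : RNode P :=
  ⟨execute u.st t, Function.update u.hist t.1 (nxHist RS u.st.loc u.hist t)⟩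

theorem nxHist_congr (RS : RSets P) {σ σ' : ∀ i, P.Local i} {h h' : ∀ i, Set (P.NStmt i)}
    (t : GStmt P) (h1 : σ t.1 = σ' t.1) (h2 : h t.1 = h' t.1) :
    nxHist RS σ h t = nxHist RS σ' h' t := by
  unfold nxHist; rw [h1, h2]

theorem nx_comm (hnb : NoBarriers P) {C : GStmt P → GStmt P → Prop} (hC : IsConflictRel P C)
    (RS : RSets P)
    {t1 t2 : GStmt P} (hI : Indep C t1 t2) {u : RNode P} (h1 : Enabled u.st t1)
    (h2 : Enabled (nx RS u t1).st t2) :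
    Enabled u.st t2 ∧ Enabled (nx RS u t2).st t1 ∧
      nx RS (nx RS u t1) t2 = nx RS (nx RS u t2) t1 := by
  obtain ⟨e1, e2, e3⟩ := exec_comm hnb hC hI h1 h2
  refine ⟨e1, e2, ?_⟩
  unfold nx
  simp only [RNode.mk.injEq]
  refine ⟨e3, ?_⟩
  rw [nxHist_congr RS (σ := (execute u.st t1).loc) (σ' := u.st.loc) (h' := u.hist) t2
      (exec_loc_ne _ _ hI.ne.symm) (Function.update_of_ne hI.ne.symm _ _),
    nxHist_congr RS (σ := (execute u.st t2).loc) (σ' := u.st.loc) (h' := u.hist) t1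
      (exec_loc_ne _ _ hI.ne) (Function.update_of_ne hI.ne _ _)]
  exact Function.update_comm hI.ne _ _ _

def Ample (RS : RSets P) (u : RNode P) (t : GStmt P) : Prop :=
  (∃ i, Normal RS u.st i) → Normal RS u.st t.1 ∧ ∀ j, Normal RS u.st j → t.1 ≤ j

theorem not_exit (hnb : NoBarriers P) {s : GState P} {t : GStmt P} (h : Enabled s t) :
    t.2 ≠ Stmt.exit := by
  obtain ⟨k, st⟩ := t
  rintro h'
  simp only at h'
  subst h'
  exact enabled_exit hnb _ _ h

theorem redge_iff (hnb : NoBarriers P) (RS : RSets P) (u : RNode P) (t : GStmt P) (v : RNode P) :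
    REdge RS u t v ↔ Enabled u.st t ∧ v = nx RS u t ∧ Ample RS u t := by
  unfold REdge
  refine and_congr_right fun he => ?_
  have hx := not_exit hnb he
  have hz : ¬ t.isExitZero := fun h => hx h.1
  obtain ⟨k, st⟩ := t
  constructor
  · rintro ⟨h1, h2, h3, h4, h5⟩
    refine ⟨?_, h5⟩
    obtain ⟨vs, vh⟩ := v
    simp only [nx, RNode.mk.injEq]
    refine ⟨h1, ?_⟩
    funext i
    by_cases hi : i = k
    · subst hi
      rw [Function.update_self]
      unfold nxHist
      cases st with
      | nsync m => exact h2 m rfl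
      | exit => exact absurd rfl hx
      | acquire l =>
        have := h3 (by rintro ⟨m, hm⟩; cases hm)
        simp only [hz, false_or] at this ⊢
        split_ifs with hh
        · exact this.1 hh
        · exact this.2 hh
      | release l =>
        have := h3 (by rintro ⟨m, hm⟩; cases hm)
        simp only [hz, false_or] at this ⊢
        split_ifs with hh
        · exact this.1 hh
        · exact this.2 hh
    · rw [Function.update_of_ne hi]
      exact (h4 i hi).2 hz
  · rintro ⟨rfl, h5⟩
    refine ⟨rfl, ?_, ?_, ?_, h5⟩
    · rintro m hm
      simp only at hm
      simp [nx, nxHist, hm]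
    · intro hn
      simp only [hz, false_or, nx, Function.update_self]
      cases st with
      | nsync m => exact absurd ⟨m, rfl⟩ hn
      | exit => exact absurd rfl hx
      | acquire l => simp +contextual [nxHist]
      | release l => simp +contextual [nxHist]
    · intro i hi
      refine ⟨fun h => absurd h hz, fun _ => ?_⟩
      exact Function.update_of_ne hi _ _

/-- run -/
noncomputable def run (RS : RSets P) (u : RNode P) (l : List (GStmt P)) : RNode P :=
  l.foldl (nx RS) u

def En (RS : RSets P) : RNode P → List (GStmt P) → Prop
  | _, [] => True
  | u, t :: l => Enabled u.st t ∧ En RS (nx RS u t) l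

theorem run_append (RS : RSets P) (u : RNode P) (l l' : List (GStmt P)) :
    run RS u (l ++ l') = run RS (run RS u l) l' := List.foldl_append

theorem En_append (RS : RSets P) (u : RNode P) (l l' : List (GStmt P)) :
    En RS u (l ++ l') ↔ En RS u l ∧ En RS (run RS u l) l' := by
  induction l generalizing u with
  | nil => simp [En, run]
  | cons t l ih => simp only [List.cons_append, En, ih, run, List.foldl_cons, and_assoc]

theorem move1 (hnb : NoBarriers P) {C : GStmt P → GStmt P → Prop} (hC : IsConflictRel P C)
    (RS : RSets P) (t : GStmt P) (A : List (GStmt P)) (u : RNode P)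
    (hI : ∀ x ∈ A, Indep C x t) (h : En RS u (A ++ [t])) :
    En RS u (t :: A) ∧ run RS u (t :: A) = run RS u (A ++ [t]) := by
  induction A generalizing u with
  | nil => exact ⟨h, rfl⟩
  | cons x A ih =>
    obtain ⟨h1, h2⟩ := h
    obtain ⟨⟨h3, h4⟩, h5⟩ := ih (nx RS u x) (fun y hy => hI y (List.mem_cons_of_mem _ hy)) h2
    obtain ⟨h6, h7, h8⟩ := nx_comm hnb hC RS (hI x List.mem_cons_self) h1 h3
    refine ⟨⟨h6, h7, h8 ▸ h4⟩, ?_⟩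
    have : run RS u (x :: A ++ [t]) = run RS (nx RS u x) (A ++ [t]) := rfl
    rw [this, ← h5]
    simp only [run, List.foldl_cons, h8]

theorem swap (hnb : NoBarriers P) {C : GStmt P → GStmt P → Prop} (hC : IsConflictRel P C)
    (RS : RSets P) (A B : List (GStmt P)) (u : RNode P)
    (hI : ∀ x ∈ A, ∀ y ∈ B, Indep C x y) (h : En RS u (A ++ B)) :
    En RS u (B ++ A) ∧ run RS u (B ++ A) = run RS u (A ++ B) := by
  induction B generalizing u with
  | nil => simpa using h
  | cons t B ih =>
    have e : A ++ t :: B = (A ++ [t]) ++ B := by simp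
    rw [e, En_append] at h
    obtain ⟨h1, h2⟩ := move1 hnb hC RS t A u (fun x hx => hI x hx t List.mem_cons_self) h.1
    have h3 : En RS (nx RS u t) (A ++ B) := by
      rw [En_append]
      refine ⟨h1.2, ?_⟩
      have := h.2
      rw [← h2] at this
      exact this
    obtain ⟨h4, h5⟩ := ih (nx RS u t) (fun x hx y hy => hI x hx y (List.mem_cons_of_mem _ hy)) h3
    refine ⟨⟨h1.1, h4⟩, ?_⟩
    have : run RS u (t :: B ++ A) = run RS (nx RS u t) (B ++ A) := rfl
    rw [this, h5, e, run_append, run_append, ← h2]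
    rfl

theorem run_loc (RS : RSets P) (u : RNode P) (l : List (GStmt P)) (i : Fin P.n)
    (h : ∀ t ∈ l, t.1 ≠ i) : (run RS u l).st.loc i = u.st.loc i := by
  induction l generalizing u with
  | nil => rfl
  | cons t l ih =>
    have : run RS u (t :: l) = run RS (nx RS u t) l := rfl
    rw [this, ih _ (fun x hx => h x (List.mem_cons_of_mem _ hx))]
    exact exec_loc_ne _ _ (h t List.mem_cons_self).symm

theorem run_lk (RS : RSets P) (u : RNode P) (A : List (GStmt P)) (l : P.Lock)
    (h : ∀ t ∈ A, t.isNsync) : (run RS u A).st.lk l = u.st.lk l := by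
  induction A generalizing u with
  | nil => rfl
  | cons t A ih =>
    have : run RS u (t :: A) = run RS (nx RS u t) A := rfl
    rw [this, ih _ (fun x hx => h x (List.mem_cons_of_mem _ hx))]
    obtain ⟨m, hm⟩ := h t List.mem_cons_self
    exact exec_lk _ _ (by unfold Touches; rw [hm]; simp)

theorem normal_iff (hnb : NoBarriers P) (RS : RSets P) (s : GState P) (i : Fin P.n) :
    Normal RS s i ↔ s.loc i ∉ RS.R i ∧ P.kind i (s.loc i) = .nsync := by
  unfold Normal
  refine and_congr_right fun h => ?_
  constructor
  · rintro ⟨st, hst⟩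
    cases st with
    | acquire l => exact absurd (RS.acq_mem _ _ _ ((enabled_acquire _ _ _).1 hst).1) h
    | release l => exact absurd (RS.rel_mem _ _ _ ((enabled_release _ _ _).1 hst).1) h
    | exit => exact absurd hst (enabled_exit hnb _ _)
    | nsync m => exact ((enabled_nsync _ _ _).1 hst).1
  · intro hk
    obtain ⟨m, hm⟩ := P.stmtsNonempty i _ hk
    exact ⟨.nsync m, (enabled_nsync _ _ _).2 ⟨hk, hm⟩⟩

theorem normal_congr (hnb : NoBarriers P) (RS : RSets P) {s s' : GState P} {i : Fin P.n}
    (h : s.loc i = s'.loc i) : Normal RS s i ↔ Normal RS s' i := by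
  rw [normal_iff hnb, normal_iff hnb, h]

theorem nsync_of_normal (hnb : NoBarriers P) (RS : RSets P) {s : GState P} {t : GStmt P}
    (hn : Normal RS s t.1) (he : Enabled s t) : t.isNsync := by
  have := ((normal_iff hnb _ _ _).1 hn).2
  obtain ⟨i, st⟩ := t
  cases st with
  | acquire l => rw [enabled_acquire, this] at he; simp at he
  | release l => rw [enabled_release, this] at he; simp at he
  | exit => exact absurd he (enabled_exit hnb _ _)
  | nsync m => exact ⟨m, rfl⟩

/-! ### HB invariance -/

theorem hb_map {ts ts' : List (GStmt P)} (σ : Equiv.Perm ℕ)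
    (hg : ∀ p, ts'[σ p]? = ts[p]?)
    (hx : ∀ t ∈ ts, t.2 ≠ Stmt.exit)
    (ho : ∀ p q t t', ts[p]? = some t → ts[q]? = some t' →
      (t.1 = t'.1 ∨ ∃ l, Touches t l ∧ Touches t' l) → p < q → σ p < σ q) (p q : ℕ)
    (h : HB ts p q) : HB ts' (σ p) (σ q) := by
  have hl : ∀ k, k < ts.length → ∃ t, ts[k]? = some t := fun k hk => ⟨_, List.getElem?_eq_getElem hk⟩
  refine Relation.TransGen.lift (p := fun j k => IntraThread ts' j k ∨ RelAcq ts' j k ∨ BarrierRel ts' j k) σ ?_ _ _ h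
  rintro p q (⟨h1, h2, h3⟩ | ⟨l, h1, ⟨t, ht, h2⟩, ⟨t', ht', h3⟩, h4⟩ | ⟨h1, h2, h3⟩)
  · left
    obtain ⟨t, ht⟩ := hl p (by omega)
    obtain ⟨t', ht'⟩ := hl q h2
    simp only [tidAt, ht, ht', Option.map_some, Option.some.injEq] at h3
    refine ⟨ho p q t t' ht ht' (Or.inl h3) h1, ?_, ?_⟩
    · by_contra hh
      have := hg q
      rw [ht', List.getElem?_eq_none (by omega)] at this
      cases this
    · simp [tidAt, hg, ht, ht', h3]
  · right; left
    refine ⟨l, ho p q t t' ht ht' (Or.inr ⟨l, Or.inr h2, Or.inl h3⟩) h1,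
      ⟨t, by rw [hg, ht], h2⟩, ⟨t', by rw [hg, ht'], h3⟩, ?_⟩
    rintro m' hm1 hm2 ⟨x, hx1, hx2⟩
    obtain ⟨m, rfl⟩ := σ.surjective m'
    rw [hg] at hx1
    refine h4 m ?_ ?_ ⟨x, hx1, hx2⟩
    · rcases lt_trichotomy p m with h | rfl | h
      · exact h
      · omega
      · have := ho m p x t hx1 ht (Or.inr ⟨l, Or.inl hx2, Or.inr h2⟩) h
        omega
    · rcases lt_trichotomy m q with h | rfl | h
      · exact h
      · omega
      · have := ho q m t' x ht' hx1 (Or.inr ⟨l, Or.inl h3, Or.inl hx2⟩) h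
        omega
  · exfalso
    have : epoch ts q = 0 := by
      unfold epoch
      convert Set.ncard_empty ℕ
      ext m
      simp only [Set.mem_ofPred_eq, Set.mem_empty_iff_false, iff_false]
      rintro ⟨-, -, t, ht, ht'⟩
      exact hx t (List.mem_of_getElem? ht) ht'
    omega

theorem hb_iff {ts ts' : List (GStmt P)} (σ : Equiv.Perm ℕ)
    (hg : ∀ p, ts'[σ p]? = ts[p]?)
    (hx : ∀ t ∈ ts, t.2 ≠ Stmt.exit)
    (ho : ∀ p q t t', ts[p]? = some t → ts[q]? = some t' →
      (t.1 = t'.1 ∨ ∃ l, Touches t l ∧ Touches t' l) → p < q → σ p < σ q) (p q : ℕ) :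
    HB ts p q ↔ HB ts' (σ p) (σ q) := by
  refine ⟨hb_map σ hg hx ho p q, fun h => ?_⟩
  have hg' : ∀ p, ts[σ.symm p]? = ts'[p]? := fun p => by rw [← hg, Equiv.apply_symm_apply]
  have := hb_map σ.symm hg' ?_ ?_ _ _ h
  · simpa using this
  · intro t ht
    obtain ⟨k, hk⟩ := List.mem_iff_getElem?.1 ht
    rw [← hg'] at hk
    exact hx t (List.mem_of_getElem? hk)
  · intro p q t t' ht ht' hh hpq
    rw [← hg'] at ht ht'
    rcases lt_trichotomy (σ.symm p) (σ.symm q) with h | h | h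
    · exact h
    · have := σ.symm.injective h; omega
    · have hh' : t'.1 = t.1 ∨ ∃ l, Touches t' l ∧ Touches t l := by
        rcases hh with h | ⟨l, h1, h2⟩
        · exact Or.inl h.symm
        · exact Or.inr ⟨l, h2, h1⟩
      have := ho _ _ t' t ht' ht hh' h
      simp at this; omega


theorem path_run (hnb : NoBarriers P) (RS : RSets P) {f : ℕ → RNode P} {ts : List (GStmt P)}
    (hp : IsPathFn RS f ts) (i n : ℕ) (h : i + n ≤ ts.length) :
    f (i + n) = run RS (f i) ((ts.drop i).take n) ∧ En RS (f i) ((ts.drop i).take n) := by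
  induction n with
  | zero => simp [run, En]
  | succ n ih =>
    obtain ⟨h1, h2⟩ := ih (by omega)
    have hk : i + n < ts.length := by omega
    have he := (redge_iff hnb RS _ _ _).1 (hp (i + n) hk)
    have : (ts.drop i).take (n+1) = (ts.drop i).take n ++ [ts.get ⟨i+n, hk⟩] := by
      rw [List.take_add_one]; simp [List.getElem?_eq_getElem hk]
    rw [this, run_append, En_append, ← h1]
    exact ⟨he.2.1, h2, he.1, trivial⟩

theorem run_path (hnb : NoBarriers P) (RS : RSets P) {u : RNode P} {ts : List (GStmt P)}
    (hE : En RS u ts)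
    (hA : ∀ k t, ts[k]? = some t → Ample RS (run RS u (ts.take k)) t) :
    IsPathFn RS (fun k => run RS u (ts.take k)) ts := by
  intro k hk
  rw [redge_iff hnb]
  have e : ts.take (k+1) = ts.take k ++ [ts.get ⟨k, hk⟩] := by
    rw [List.take_add_one]; simp [List.getElem?_eq_getElem hk]
  refine ⟨?_, ?_, hA k _ (by simp [List.getElem?_eq_getElem hk])⟩
  · rw [← List.take_append_drop (k+1) ts, e, En_append, En_append] at hE
    exact hE.1.2.1
  · simp only [e, run_append]
    rfl

theorem swap_get (ts : List (GStmt P)) (a b d : ℕ) (h1 : a ≤ b) (h2 : b ≤ d) (h3 : d ≤ ts.length)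
    (p : ℕ) :
    (ts.take a ++ ((ts.drop b).take (d - b)) ++ ((ts.drop a).take (b - a))
      ++ ts.drop d)[segSwap a b d p]? = ts[p]? := by
  unfold segSwap
  simp only [List.getElem?_append, List.getElem?_take, List.getElem?_drop, List.length_append,
    List.length_take, List.length_drop]
  split_ifs <;> first | omega | rfl | (congr 1; omega)

def segPerm (a b d : ℕ) (h1 : a ≤ b) (h2 : b ≤ d) : Equiv.Perm ℕ where
  toFun := segSwap a b d
  invFun := segSwap a (a + (d - b)) d
  left_inv := by intro m; unfold segSwap; split_ifs <;> omega
  right_inv := by intro m; unfold segSwap; split_ifs <;> omega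

theorem lk_const (hnb : NoBarriers P) (RS : RSets P) {f : ℕ → RNode P} {ts : List (GStmt P)}
    (hp : IsPathFn RS f ts) (i n : ℕ) (h : i + n ≤ ts.length) (l : P.Lock)
    (hn : ∀ k t, i ≤ k → k < i + n → ts[k]? = some t → t.isNsync) :
    (f (i + n)).st.lk l = (f i).st.lk l := by
  rw [(path_run hnb RS hp i n h).1]
  apply run_lk
  intro t ht
  obtain ⟨k, hk⟩ := List.mem_iff_getElem?.1 ht
  rw [List.getElem?_take] at hk
  split_ifs at hk with hkn
  rw [List.getElem?_drop] at hk
  exact hn (i + k) t (by omega) (by omega) hk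

/-- Core lemma in terms of positions. -/
theorem core (hnb : NoBarriers P) (RS : RSets P)
    (C : GStmt P → GStmt P → Prop) (hC : IsConflictRel P C)
    (f : ℕ → RNode P) (ts ts' : List (GStmt P)) (hpath : IsPathFn RS f ts)
    (a b d : ℕ) (hab : a < b) (hbd : b < d) (hd : d ≤ ts.length)
    (hts' : ts' = ts.take a ++ ((ts.drop b).take (d - b)) ++ ((ts.drop a).take (b - a))
      ++ ts.drop d)
    (x0 y0 : GStmt P) (hx0 : ts[a]? = some x0) (hy0 : ts[b]? = some y0)
    (hA : ∀ k, a < k → k < b → SameBlockStep RS f ts a k)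
    (hB : ∀ k, b < k → k < d → SameBlockStep RS f ts b k)
    (hni : ¬ Normal RS (f a).st x0.1)
    (hcomp : ¬ Normal RS (f d).st y0.1)
    (hhb : ¬ HB ts a b)
    (hnc : ∀ p q, a ≤ p → p < b → b ≤ q → q < d →
      ∀ t1 t2, ts[p]? = some t1 → ts[q]? = some t2 → ¬ C t1 t2) :
    ∃ f' : ℕ → RNode P, IsPathFn RS f' ts' ∧
      (∀ k, k ≤ a → f' k = f k) ∧ (∀ k, d ≤ k → k ≤ ts.length → f' k = f k) ∧
      (∀ i, ¬ Normal RS (f a).st i) ∧ (∀ i, ¬ Normal RS (f d).st i) ∧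
      (∀ i, ¬ Normal RS (f' (a + (d - b))).st i) ∧
      (∀ y, 0 < y → y < d - b → Normal RS (f' (a + y)).st y0.1) ∧
      (∀ x, 0 < x → x < b - a → Normal RS (f' (a + (d - b) + x)).st x0.1) ∧
      (∀ p q, Races C ts p q ↔ Races C ts' (segSwap a b d p) (segSwap a b d q)) := by
  have hg : ∀ p, ts'[segSwap a b d p]? = ts[p]? := by
    intro p; rw [hts']; exact swap_get ts a b d hab.le hbd.le hd p
  have hL : ∀ k, k < ts.length → ∃ t, ts[k]? = some t :=
    fun k hk => ⟨_, List.getElem?_eq_getElem hk⟩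
  have hedge : ∀ k t, ts[k]? = some t →
      Enabled (f k).st t ∧ f (k+1) = nx RS (f k) t ∧ Ample RS (f k) t := by
    intro k t hk
    obtain ⟨hk', rfl⟩ := List.getElem?_eq_some_iff.1 hk
    exact (redge_iff hnb RS _ _ _).1 (hpath k hk')
  -- tids and normality along the blocks
  have hA' : ∀ k, a < k → k < b → ∀ t, ts[k]? = some t → t.1 = x0.1 ∧ Normal RS (f k).st x0.1 := by
    intro k h1 h2 t ht
    obtain ⟨h3, t', ht', h4⟩ := hA k h1 h2
    rw [ht] at ht'; cases ht'
    simp only [tidAt, ht, hx0, Option.map_some, Option.some.injEq] at h3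
    exact ⟨h3, h3 ▸ h4⟩
  have hB' : ∀ k, b < k → k < d → ∀ t, ts[k]? = some t → t.1 = y0.1 ∧ Normal RS (f k).st y0.1 := by
    intro k h1 h2 t ht
    obtain ⟨h3, t', ht', h4⟩ := hB k h1 h2
    rw [ht] at ht'; cases ht'
    simp only [tidAt, ht, hy0, Option.map_some, Option.some.injEq] at h3
    exact ⟨h3, h3 ▸ h4⟩
  have hAt : ∀ k t, a ≤ k → k < b → ts[k]? = some t → t.1 = x0.1 := by
    intro k t h1 h2 ht
    rcases h1.eq_or_lt with rfl | h1
    · rw [hx0] at ht; cases ht; rfl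
    · exact (hA' k h1 h2 t ht).1
  have hBt : ∀ k t, b ≤ k → k < d → ts[k]? = some t → t.1 = y0.1 := by
    intro k t h1 h2 ht
    rcases h1.eq_or_lt with rfl | h1
    · rw [hy0] at ht; cases ht; rfl
    · exact (hB' k h1 h2 t ht).1
  have hAn : ∀ k t, a < k → k < b → ts[k]? = some t → t.isNsync := by
    intro k t h1 h2 ht
    obtain ⟨h3, h4⟩ := hA' k h1 h2 t ht
    exact nsync_of_normal hnb RS (h3 ▸ h4) (hedge k t ht).1
  have hBn : ∀ k t, b < k → k < d → ts[k]? = some t → t.isNsync := by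
    intro k t h1 h2 ht
    obtain ⟨h3, h4⟩ := hB' k h1 h2 t ht
    exact nsync_of_normal hnb RS (h3 ▸ h4) (hedge k t ht).1
  have hN0 : ∀ i, ¬ Normal RS (f a).st i := fun i hi =>
    hni ((hedge a x0 hx0).2.2 ⟨i, hi⟩).1
  have hne : x0.1 ≠ y0.1 := by
    intro h
    refine hhb (Relation.TransGen.single (Or.inl ⟨hab, by omega, ?_⟩))
    simp [tidAt, hx0, hy0, h]
  -- the segments
  obtain ⟨A, hAdef⟩ : ∃ A, A = (ts.drop a).take (b - a) := ⟨_, rfl⟩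
  obtain ⟨B, hBdef⟩ : ∃ B, B = (ts.drop b).take (d - b) := ⟨_, rfl⟩
  have hAl : A.length = b - a := by rw [hAdef]; simp; omega
  have hBl : B.length = d - b := by rw [hBdef]; simp; omega
  have hAm : ∀ t ∈ A, ∃ k, a ≤ k ∧ k < b ∧ ts[k]? = some t := by
    intro t ht
    obtain ⟨k, hk⟩ := List.mem_iff_getElem?.1 ht
    rw [hAdef, List.getElem?_take] at hk
    split_ifs at hk
    rw [List.getElem?_drop] at hk
    exact ⟨a + k, by omega, by omega, hk⟩
  have hBm : ∀ t ∈ B, ∃ k, b ≤ k ∧ k < d ∧ ts[k]? = some t := by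
    intro t ht
    obtain ⟨k, hk⟩ := List.mem_iff_getElem?.1 ht
    rw [hBdef, List.getElem?_take] at hk
    split_ifs at hk
    rw [List.getElem?_drop] at hk
    exact ⟨b + k, by omega, by omega, hk⟩
  have hAtid : ∀ t ∈ A, t.1 = x0.1 := by
    intro t ht; obtain ⟨k, h1, h2, h3⟩ := hAm t ht; exact hAt k t h1 h2 h3
  have hBtid : ∀ t ∈ B, t.1 = y0.1 := by
    intro t ht; obtain ⟨k, h1, h2, h3⟩ := hBm t ht; exact hBt k t h1 h2 h3
  have hfA : ∀ x, x ≤ b - a → f (a + x) = run RS (f a) (A.take x) := by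
    intro x hx
    rw [(path_run hnb RS hpath a x (by omega)).1, hAdef, List.take_take, min_eq_left hx]
  have hfb : f b = run RS (f a) A := by
    have := hfA (b - a) le_rfl
    rwa [show a + (b - a) = b by omega, List.take_of_length_le hAl.le] at this
  have hfB : ∀ y, y ≤ d - b → f (b + y) = run RS (f a) (A ++ B.take y) := by
    intro y hy
    rw [run_append, ← hfb, (path_run hnb RS hpath b y (by omega)).1, hBdef, List.take_take,
      min_eq_left hy]
  have hfd : f d = run RS (f a) (A ++ B) := by
    have := hfB (d - b) le_rfl
    rwa [show b + (d - b) = d by omega, List.take_of_length_le hBl.le] at this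
  have hEA : En RS (f a) A := by
    rw [hAdef]; exact (path_run hnb RS hpath a (b - a) (by omega)).2
  have hEB : En RS (f b) B := by
    rw [hBdef]; exact (path_run hnb RS hpath b (d - b) (by omega)).2
  have hEAB : En RS (f a) (A ++ B) := by
    rw [En_append, ← hfb]; exact ⟨hEA, hEB⟩
  -- independence
  have hlock : ∀ l, Touches x0 l → ¬ Touches y0 l := by
    intro l hx hy
    have e1 : (f b).st.lk l = (execute (f a).st x0).lk l := by
      have := lk_const hnb RS hpath (a+1) (b - (a+1)) (by omega) l
        (fun k t h1 h2 ht => hAn k t (by omega) (by omega) ht)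
      rw [show a + 1 + (b - (a+1)) = b by omega, (hedge a x0 hx0).2.1] at this
      exact this
    have ey := (hedge b y0 hy0).1
    have hra : x0.2 = Stmt.release l → y0.2 ≠ Stmt.acquire l := by
      intro h1 h2
      refine hhb (Relation.TransGen.single (Or.inr (Or.inl ⟨l, hab, ⟨x0, hx0, h1⟩, ⟨y0, hy0, h2⟩, ?_⟩)))
      rintro m h3 h4 ⟨t, ht, ht'⟩
      obtain ⟨s, hs⟩ := hAn m t h3 h4 ht
      unfold GStmt.isAcquireOn at ht'
      rw [hs] at ht'; cases ht'
    clear hhb hA hB hA' hB' hni hcomp hN0 hAt hBt hAtid hBtid hx0 hy0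
    obtain ⟨i, x⟩ := x0
    obtain ⟨k, y⟩ := y0
    unfold Touches at hx hy
    simp only at hx hy hra hne
    rcases hx with rfl | rfl <;> rcases hy with rfl | rfl
    · rw [enabled_acquire, e1] at ey; simp [execute] at ey
    · rw [enabled_release, e1] at ey; simp [execute] at ey; exact hne ey.2
    · exact hra rfl rfl
    · rw [enabled_release, e1] at ey; simp [execute] at ey
  have hInd : ∀ p q t1 t2, a ≤ p → p < b → b ≤ q → q < d → ts[p]? = some t1 → ts[q]? = some t2 →
      Indep C t1 t2 := by
    intro p q t1 t2 h1 h2 h3 h4 h5 h6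
    refine ⟨?_, hnc p q h1 h2 h3 h4 t1 t2 h5 h6, ?_⟩
    · rw [hAt p t1 h1 h2 h5, hBt q t2 h3 h4 h6]; exact hne
    · have nt : ∀ t : GStmt P, ∀ l, t.isNsync → ¬ Touches t l := by
        rintro t l ⟨m, hm⟩ (h | h) <;> rw [hm] at h <;> cases h
      rcases h1.eq_or_lt with rfl | h1
      · rcases h3.eq_or_lt with rfl | h3
        · rw [hx0] at h5; rw [hy0] at h6; cases h5; cases h6; exact hlock
        · exact fun l _ => nt _ l (hBn q t2 h3 h4 h6)
      · exact fun l h => absurd h (nt _ l (hAn p t1 h1 h2 h5))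
  have hIAB : ∀ x ∈ A, ∀ y ∈ B, Indep C x y := by
    intro x hx y hy
    obtain ⟨p, h1, h2, h3⟩ := hAm x hx
    obtain ⟨q, h4, h5, h6⟩ := hBm y hy
    exact hInd p q x y h1 h2 h4 h5 h3 h6
  have hswB : ∀ y, run RS (f a) (B.take y ++ A) = run RS (f a) (A ++ B.take y) := by
    intro y
    refine (swap hnb hC RS A (B.take y) (f a)
      (fun x hx z hz => hIAB x hx z (List.mem_of_mem_take hz)) ?_).2
    rw [← List.take_append_drop y B, ← List.append_assoc, En_append] at hEAB
    exact hEAB.1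
  have hswA : ∀ x, run RS (f a) (B ++ A.take x) = run RS (f a) (A.take x ++ B) := by
    intro x
    obtain ⟨h1, h2⟩ := swap hnb hC RS A B (f a) hIAB hEAB
    -- En (A.take x ++ B) is obtained by moving the rest of A past B
    have hE2 : En RS (run RS (f a) (A.take x)) (A.drop x ++ B) := by
      have := hEAB
      rw [← List.take_append_drop x A, List.append_assoc, En_append] at this
      exact this.2
    have hE3 := (swap hnb hC RS (A.drop x) B _
      (fun z hz y hy => hIAB z (List.mem_of_mem_drop hz) y hy) hE2).1
    rw [En_append] at hE3
    refine (swap hnb hC RS (A.take x) B (f a)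
      (fun z hz y hy => hIAB z (List.mem_of_mem_take hz) y hy) ?_).2
    rw [En_append]
    refine ⟨?_, hE3.1⟩
    have := hEA
    rw [← List.take_append_drop x A, En_append] at this
    exact this.1
  obtain ⟨hEBA, hBA⟩ := swap hnb hC RS A B (f a) hIAB hEAB
  -- local states
  have L1 : ∀ y, y ≤ d - b →
      (run RS (f a) (B.take y)).st.loc y0.1 = (f (b + y)).st.loc y0.1 := by
    intro y hy
    rw [hfB y hy, ← hswB, run_append]
    exact (run_loc RS _ A _ (fun t ht => by rw [hAtid t ht]; exact hne)).symm
  have L2 : ∀ y i, i ≠ y0.1 → (run RS (f a) (B.take y)).st.loc i = (f a).st.loc i := by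
    intro y i hi
    exact run_loc RS _ _ _ (fun t ht => by rw [hBtid t (List.mem_of_mem_take ht)]; exact hi.symm)
  have L3 : ∀ x, x ≤ b - a →
      (run RS (f a) (B ++ A.take x)).st.loc x0.1 = (f (a + x)).st.loc x0.1 := by
    intro x hx
    rw [hfA x hx, hswA, run_append]
    exact (run_loc RS _ B _ (fun t ht => by rw [hBtid t ht]; exact hne.symm))
  have L4 : ∀ x i, i ≠ x0.1 → (run RS (f a) (B ++ A.take x)).st.loc i = (run RS (f a) B).st.loc i := by
    intro x i hi
    rw [run_append]
    exact run_loc RS _ _ _ (fun t ht => by rw [hAtid t (List.mem_of_mem_take ht)]; exact hi.symm)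
  -- no normal thread at f b
  have hoth : ∀ i, i ≠ x0.1 → ¬ Normal RS (f b).st i := by
    intro i hi
    rw [normal_congr hnb RS (s' := (f a).st)]
    · exact hN0 i
    · rw [hfb]; exact run_loc RS _ _ _ (fun t ht => by rw [hAtid t ht]; exact hi.symm)
  have hNb : ∀ i, ¬ Normal RS (f b).st i := by
    intro i hi
    have h1 := ((hedge b y0 hy0).2.2 ⟨i, hi⟩).1
    exact hoth _ hne.symm h1
  have hNd : ∀ i, ¬ Normal RS (f d).st i := by
    intro i
    by_cases hi : i = y0.1
    · rw [hi]; exact hcomp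
    · rw [normal_congr hnb RS (s' := (f b).st)]
      · exact hNb i
      · rw [hfd, run_append, ← hfb]
        exact run_loc RS _ _ _ (fun t ht => by rw [hBtid t ht]; exact (Ne.symm hi))
  have hBtake : B.take (d - b) = B := List.take_of_length_le hBl.le
  have hNB : ∀ y i, y ≤ d - b → Normal RS (run RS (f a) (B.take y)).st i →
      i = y0.1 ∧ 0 < y ∧ y < d - b := by
    intro y i hy hn
    by_cases hi : i = y0.1
    · refine ⟨hi, ?_⟩
      subst hi
      rw [normal_congr hnb RS (L1 y hy)] at hn
      refine ⟨Nat.pos_of_ne_zero ?_, lt_of_le_of_ne hy ?_⟩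
      · rintro rfl; exact hNb _ hn
      · rintro rfl; rw [show b + (d - b) = d by omega] at hn; exact hNd _ hn
    · rw [normal_congr hnb RS (L2 y i hi)] at hn
      exact absurd hn (hN0 i)
  have hNB0 : ∀ i, ¬ Normal RS (run RS (f a) B).st i := by
    intro i hn
    rw [← hBtake] at hn
    have := hNB (d - b) i le_rfl hn
    omega
  have hNA : ∀ x i, x ≤ b - a → Normal RS (run RS (f a) (B ++ A.take x)).st i →
      i = x0.1 ∧ 0 < x ∧ x < b - a := by
    intro x i hx hn
    by_cases hi : i = x0.1
    · refine ⟨hi, ?_⟩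
      subst hi
      rw [normal_congr hnb RS (L3 x hx)] at hn
      refine ⟨Nat.pos_of_ne_zero ?_, lt_of_le_of_ne hx ?_⟩
      · rintro rfl; exact hN0 _ hn
      · rintro rfl; rw [show a + (b - a) = b by omega] at hn; exact hNb _ hn
    · rw [normal_congr hnb RS (L4 x i hi)] at hn
      exact absurd hn (hNB0 i)
  have hNB' : ∀ y, 0 < y → y < d - b → Normal RS (run RS (f a) (B.take y)).st y0.1 := by
    intro y h1 h2
    rw [normal_congr hnb RS (L1 y h2.le)]
    obtain ⟨t, ht⟩ := hL (b + y) (by omega)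
    exact (hB' (b + y) (by omega) (by omega) t ht).2
  have hNA' : ∀ x, 0 < x → x < b - a → Normal RS (run RS (f a) (B ++ A.take x)).st x0.1 := by
    intro x h1 h2
    rw [normal_congr hnb RS (L3 x h2.le)]
    obtain ⟨t, ht⟩ := hL (a + x) (by omega)
    exact (hA' (a + x) (by omega) (by omega) t ht).2
  -- the new path
  rw [← hAdef, ← hBdef] at hts'
  have hfpre : ∀ k, k ≤ ts.length → f k = run RS (f 0) (ts.take k) := by
    intro k hk
    have := (path_run hnb RS hpath 0 k (by omega)).1
    simpa using this
  have hal : (ts.take a).length = a := by simp; omega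
  have F1 : ∀ k, k ≤ a → run RS (f 0) (ts'.take k) = f k := by
    intro k hk
    rw [hfpre k (by omega), hts', List.append_assoc, List.append_assoc,
      List.take_append_of_le_length (by omega), List.take_take, min_eq_left hk]
  have F2 : ∀ y, y ≤ d - b → run RS (f 0) (ts'.take (a + y)) = run RS (f a) (B.take y) := by
    intro y hy
    have : ts'.take (a + y) = ts.take a ++ B.take y := by
      rw [hts', List.append_assoc, List.append_assoc, List.take_append, hal,
        show a + y - a = y by omega, List.take_of_length_le (by omega),
        List.take_append_of_le_length (by omega)]
    rw [this, run_append, ← hfpre a (by omega)]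
  have F3 : ∀ x, x ≤ b - a →
      run RS (f 0) (ts'.take (a + (d - b) + x)) = run RS (f a) (B ++ A.take x) := by
    intro x hx
    have : ts'.take (a + (d - b) + x) = ts.take a ++ (B ++ A.take x) := by
      rw [hts', List.append_assoc, List.append_assoc, List.take_append, hal,
        show a + (d - b) + x - a = (d - b) + x by omega, List.take_of_length_le (by omega),
        List.take_append, hBl, List.take_of_length_le (l := B) (by omega),
        show d - b + x - (d - b) = x by omega, List.take_append_of_le_length (by omega)]
    rw [this, run_append, ← hfpre a (by omega)]
  have F4 : ∀ k, d ≤ k → k ≤ ts.length → run RS (f 0) (ts'.take k) = f k := by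
    intro k h1 h2
    have : ts'.take k = ts.take a ++ (B ++ A) ++ (ts.drop d).take (k - d) := by
      rw [hts', List.append_assoc (ts.take a), List.take_append,
        List.take_of_length_le (by simp [hAl, hBl]; omega)]
      congr 2
      simp [hAl, hBl]; omega
    rw [this, run_append, run_append, ← hfpre a (by omega), hBA, ← hfd]
    have := (path_run hnb RS hpath d (k - d) (by omega)).1
    rw [show d + (k - d) = k by omega] at this
    exact this.symm
  have hE' : En RS (f 0) ts' := by
    have h1 := (path_run hnb RS hpath 0 a (by omega)).2
    have h2 := (path_run hnb RS hpath d (ts.length - d) (by omega)).2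
    simp only [List.drop_zero] at h1
    rw [List.take_of_length_le (by simp)] at h2
    rw [hts', List.append_assoc (ts.take a), En_append, En_append, run_append,
      ← hfpre a (by omega), hBA, ← hfd]
    exact ⟨⟨h1, hEBA⟩, h2⟩
  have G1 : ∀ k, k < a → ts'[k]? = ts[k]? := by
    intro k hk; rw [← hg k]; congr 1; unfold segSwap; simp [hk]
  have G2 : ∀ y, y < d - b → ts'[a + y]? = ts[b + y]? := by
    intro k hk; rw [← hg (b + k)]; congr 1; unfold segSwap; split_ifs <;> omega
  have G3 : ∀ x, x < b - a → ts'[a + (d - b) + x]? = ts[a + x]? := by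
    intro k hk; rw [← hg (a + k)]; congr 1; unfold segSwap; split_ifs <;> omega
  have G4 : ∀ k, d ≤ k → ts'[k]? = ts[k]? := by
    intro k hk; rw [← hg k]; congr 1; unfold segSwap; split_ifs <;> omega
  refine ⟨fun k => run RS (f 0) (ts'.take k), run_path hnb RS hE' ?_, F1, F4, hN0, hNd, ?_, ?_, ?_,
    ?_⟩
  · intro k t ht
    by_cases k1 : k < a
    · rw [F1 k k1.le]; rw [G1 k k1] at ht; exact (hedge k t ht).2.2
    by_cases k2 : k < a + (d - b)
    · obtain ⟨y, rfl⟩ : ∃ y, k = a + y := ⟨k - a, by omega⟩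
      rw [F2 y (by omega)]; rw [G2 y (by omega)] at ht
      have e := hBt (b + y) t (by omega) (by omega) ht
      rintro ⟨i, hi⟩
      have h1 := hNB y i (by omega) hi
      rw [e]
      refine ⟨h1.1 ▸ hi, fun m hm => ?_⟩
      rw [(hNB y m (by omega) hm).1]
    by_cases k3 : k < d
    · obtain ⟨x, rfl⟩ : ∃ x, k = a + (d - b) + x := ⟨k - (a + (d - b)), by omega⟩
      rw [F3 x (by omega)]; rw [G3 x (by omega)] at ht
      have e := hAt (a + x) t (by omega) (by omega) ht
      rintro ⟨i, hi⟩
      have h1 := hNA x i (by omega) hi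
      rw [e]
      refine ⟨h1.1 ▸ hi, fun m hm => ?_⟩
      rw [(hNA x m (by omega) hm).1]
    · rw [G4 k (by omega)] at ht
      rw [F4 k (by omega) (List.getElem?_eq_some_iff.1 ht).1.le]
      exact (hedge k t ht).2.2
  · intro i
    simp only
    rw [F2 (d - b) le_rfl, hBtake]; exact hNB0 i
  · intro y h1 h2
    simp only
    rw [F2 y h2.le]; exact hNB' y h1 h2
  · intro x h1 h2
    simp only
    rw [F3 x h2.le]; exact hNA' x h1 h2
  · have hx : ∀ t ∈ ts, t.2 ≠ Stmt.exit := by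
      intro t ht
      obtain ⟨k, hk⟩ := List.mem_iff_getElem?.1 ht
      exact not_exit hnb (hedge k t hk).1
    have key : ∀ p q, HB ts p q ↔ HB ts' (segSwap a b d p) (segSwap a b d q) := by
      intro p q
      refine hb_iff (segPerm a b d hab.le hbd.le) hg hx ?_ p q
      intro p q t t' ht ht' hdep hpq
      change segSwap a b d p < segSwap a b d q
      by_cases hc : a ≤ p ∧ p < b ∧ b ≤ q ∧ q < d
      · exfalso
        have hi := hInd p q t t' hc.1 hc.2.1 hc.2.2.1 hc.2.2.2 ht ht'
        rcases hdep with h | ⟨l, h1, h2⟩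
        · exact hi.ne h
        · exact hi.lock l h1 h2
      · unfold segSwap; split_ifs <;> omega
    intro p q
    unfold Races
    rw [hg, hg, ← key, ← key]

/-- Block transposition lemma: a non-initial block may be transposed with the
following complete, HB-unordered, non-conflicting block, yielding a path with
the same data race relation (up to the induced position permutation). -/
theorem stmt14 (P : Program) (hnb : NoBarriers P) (RS : RSets P)
    (C : GStmt P → GStmt P → Prop) (hC : IsConflictRel P C)
    (f : ℕ → RNode P) (ts : List (GStmt P)) (hpath : IsPathFn RS f ts)
    (N : ℕ) (c : ℕ → ℕ) (hbd : IsBlockDecomp RS f ts N c)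
    (j : ℕ) (hj : j + 1 < N)
    (hni : ¬ BlockInitial RS f ts c j)
    (hcomp : BlockComplete RS f ts c (j+1))
    (hhb : ¬ HB ts (c j) (c (j+1)))
    (hnc : ∀ p q, c j ≤ p → p < c (j+1) → c (j+1) ≤ q → q < c (j+2) →
      ∀ t1 t2, ts[p]? = some t1 → ts[q]? = some t2 → ¬ C t1 t2) :
    ∃ f' : ℕ → RNode P,
      IsPathFn RS f'
        (ts.take (c j) ++ ((ts.drop (c (j+1))).take (c (j+2) - c (j+1)))
          ++ ((ts.drop (c j)).take (c (j+1) - c j)) ++ ts.drop (c (j+2))) ∧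
      f' 0 = f 0 ∧
      IsBlockDecomp RS f'
        (ts.take (c j) ++ ((ts.drop (c (j+1))).take (c (j+2) - c (j+1)))
          ++ ((ts.drop (c j)).take (c (j+1) - c j)) ++ ts.drop (c (j+2))) N
        (fun m => if m ≤ j then c m
          else if m = j + 1 then c j + (c (j+2) - c (j+1)) else c m) ∧
      (∀ p q, Races C ts p q ↔
        Races C
          (ts.take (c j) ++ ((ts.drop (c (j+1))).take (c (j+2) - c (j+1)))
            ++ ((ts.drop (c j)).take (c (j+1) - c j)) ++ ts.drop (c (j+2)))
          (segSwap (c j) (c (j+1)) (c (j+2)) p)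
          (segSwap (c j) (c (j+1)) (c (j+2)) q)) := by
  have hstep : ∀ m n, m + n ≤ N → c m + n ≤ c (m + n) := by
    intro m n
    induction n with
    | zero => intro _; simp
    | succ n ih =>
      intro h
      have h1 := ih (by omega)
      have h2 := hbd.mono (m + n) (by omega)
      have h3 : c (m + (n + 1)) = c (m + n + 1) := rfl
      omega
  have hmono : ∀ m n, m ≤ n → n ≤ N → c m + (n - m) ≤ c n := by
    intro m n h1 h2
    have := hstep m (n - m) (by omega)
    rwa [show m + (n - m) = n by omega] at this
  have hlen := hbd.last
  have hab : c j < c (j+1) := hbd.mono j (by omega)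
  have hbd' : c (j+1) < c (j+2) := hbd.mono (j+1) (by omega)
  have hd : c (j+2) ≤ ts.length := by
    have := hmono (j+2) N (by omega) le_rfl
    omega
  have hx0 : ts[c j]? = some (ts[c j]'(by omega)) := List.getElem?_eq_getElem _
  have hy0 : ts[c (j+1)]? = some (ts[c (j+1)]'(by omega)) := List.getElem?_eq_getElem _
  generalize ts[c j]'(by omega) = x0 at hx0
  generalize ts[c (j+1)]'(by omega) = y0 at hy0
  generalize hts' : ts.take (c j) ++ ((ts.drop (c (j+1))).take (c (j+2) - c (j+1)))
          ++ ((ts.drop (c j)).take (c (j+1) - c j)) ++ ts.drop (c (j+2)) = ts'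
  obtain ⟨f', hp, F1, F4, hN0, hNd, hNe, hNB, hNA, hR⟩ := core hnb RS C hC f ts ts' hpath
    (c j) (c (j+1)) (c (j+2)) hab hbd' hd hts'.symm x0 y0 hx0 hy0
    (hbd.inside j (by omega)) (hbd.inside (j+1) (by omega))
    (fun h => hni ⟨x0, hx0, h⟩) (hcomp y0 hy0) hhb hnc
  refine ⟨f', hp, F1 0 (by omega), ?_, hR⟩
  have hg : ∀ p, ts'[segSwap (c j) (c (j+1)) (c (j+2)) p]? = ts[p]? := by
    intro p; rw [← hts']; exact swap_get ts _ _ _ hab.le hbd'.le hd p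
  have hlen' : ts'.length = ts.length := by
    rw [← hts']; simp; omega
  have G1 : ∀ k, k < c j → ts'[k]? = ts[k]? := by
    intro k hk; rw [← hg k]; congr 1; unfold segSwap; simp [hk]
  have G2 : ∀ y, y < c (j+2) - c (j+1) → ts'[c j + y]? = ts[c (j+1) + y]? := by
    intro k hk; rw [← hg (c (j+1) + k)]; congr 1; unfold segSwap; split_ifs <;> omega
  have G3 : ∀ x, x < c (j+1) - c j → ts'[c j + (c (j+2) - c (j+1)) + x]? = ts[c j + x]? := by
    intro k hk; rw [← hg (c j + k)]; congr 1; unfold segSwap; split_ifs <;> omega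
  have G4 : ∀ k, c (j+2) ≤ k → ts'[k]? = ts[k]? := by
    intro k hk; rw [← hg k]; congr 1; unfold segSwap; split_ifs <;> omega
  have trans : ∀ p m, ts'[p]? = ts[p]? → ts'[m]? = ts[m]? → f' m = f m →
      (SameBlockStep RS f' ts' p m ↔ SameBlockStep RS f ts p m) := by
    intro p m h1 h2 h3
    unfold SameBlockStep tidAt
    rw [h1, h2, h3]
  have nsb : ∀ p m, (∀ i, ¬ Normal RS (f' m).st i) → ¬ SameBlockStep RS f' ts' p m := by
    rintro p m h ⟨_, t, _, ht⟩
    exact h _ ht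
  constructor
  · simp [hbd.zero]
  · simp only [show ¬ N ≤ j by omega, show N ≠ j + 1 by omega, if_false, hlen, hlen']
  · intro i hi
    have hm := hbd.mono i hi
    rcases lt_trichotomy i j with h | rfl | h
    · simp only [show i ≤ j by omega, show i + 1 ≤ j by omega, if_true, hm]
    · simp; omega
    · by_cases h' : i = j + 1
      · subst h'
        have h3 : c (j + 1 + 1) = c (j + 2) := rfl
        simp; omega
      · simp only [show ¬ i ≤ j by omega, show i ≠ j + 1 by omega, show ¬ i + 1 ≤ j by omega,
          show i + 1 ≠ j + 1 by omega, if_false, hm]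
  · intro i hi m
    rcases lt_trichotomy i j with h | rfl | h
    · simp only [show i ≤ j by omega, show i + 1 ≤ j by omega, if_true]
      intro h1 h2
      have := hmono (i+1) j (by omega) (by omega)
      exact (trans _ _ (G1 _ (by omega)) (G1 _ (by omega)) (F1 _ (by omega))).2
        (hbd.inside i hi m h1 h2)
    · simp
      intro h1 h2
      obtain ⟨y, rfl⟩ : ∃ y, m = c i + y := ⟨m - c i, by omega⟩
      obtain ⟨h3, t, ht, h4⟩ := hbd.inside (i+1) (by omega) (c (i+1) + y) (by omega)
        (show _ < c (i+2) by omega)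
      have hz := G2 0 (by omega)
      simp only [Nat.add_zero] at hz
      have h5 : t.1 = y0.1 := by
        simpa [tidAt, ht, hy0] using h3
      refine ⟨?_, t, ?_, ?_⟩
      · unfold tidAt at h3 ⊢
        rw [hz, G2 y (by omega)]; exact h3
      · rw [G2 y (by omega)]; exact ht
      · rw [h5]; exact hNB y (by omega) (by omega)
    · by_cases h' : i = j + 1
      · subst h'
        simp
        intro h1 h2
        have h2' : m < c (j+2) := h2
        obtain ⟨x, rfl⟩ : ∃ x, m = c j + (c (j+2) - c (j+1)) + x :=
          ⟨m - (c j + (c (j+2) - c (j+1))), by omega⟩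
        obtain ⟨h3, t, ht, h4⟩ := hbd.inside j (by omega) (c j + x) (by omega) (by omega)
        have hz := G3 0 (by omega)
        simp only [Nat.add_zero] at hz
        have h5 : t.1 = x0.1 := by
          simpa [tidAt, ht, hx0] using h3
        refine ⟨?_, t, ?_, ?_⟩
        · unfold tidAt at h3 ⊢
          rw [hz, G3 x (by omega)]; exact h3
        · rw [G3 x (by omega)]; exact ht
        · rw [h5]; exact hNA x (by omega) (by omega)
      · simp only [show ¬ i ≤ j by omega, show i ≠ j + 1 by omega, show ¬ i + 1 ≤ j by omega,
          show i + 1 ≠ j + 1 by omega, if_false]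
        intro h1 h2
        have e1 := hmono (j+2) i (by omega) (by omega)
        have e2 := hmono (i+1) N (by omega) (by omega)
        exact (trans _ _ (G4 _ (by omega)) (G4 _ (by omega)) (F4 _ (by omega) (by omega))).2
          (hbd.inside i hi m h1 h2)
  · intro i hi
    rw [hlen']
    rcases lt_trichotomy i j with h | rfl | h
    · simp only [show i ≤ j by omega, show i + 1 ≤ j by omega, if_true]
      intro h1
      have e1 := hmono i (i+1) (by omega) (by omega)
      by_cases h' : i + 1 = j
      · rw [h']
        apply nsb
        rw [F1 _ le_rfl]; exact hN0
      · have := hmono (i+1) j (by omega) (by omega)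
        rw [trans _ _ (G1 _ (by omega)) (G1 _ (by omega)) (F1 _ (by omega))]
        exact hbd.boundary i hi h1
    · simp
      intro _
      exact nsb _ _ hNe
    · by_cases h' : i = j + 1
      · subst h'
        simp only [show ¬ j + 1 + 1 ≤ j by omega, show j + 1 + 1 ≠ j + 1 by omega, if_false]
        intro _
        apply nsb
        have := F4 (c (j+2)) le_rfl hd
        change ∀ i, ¬ Normal RS (f' (c (j+2))).st i
        rw [this]; exact hNd
      · simp only [show ¬ i ≤ j by omega, show i ≠ j + 1 by omega, show ¬ i + 1 ≤ j by omega,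
          show i + 1 ≠ j + 1 by omega, if_false]
        intro h1
        have e1 := hmono (j+2) i (by omega) (by omega)
        have e2 := hmono i (i+1) (by omega) (by omega)
        rw [trans _ _ (G4 _ (by omega)) (G4 _ (by omega)) (F4 _ (by omega) (by omega))]
        exact hbd.boundary i hi h1



end MC
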